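/- Suppose there exists an automorphism f of the weighted graph (G,a) with f(v₀) = v₁ and f(v₁) = v₀, and assume E_{ℚ_{v₀,e₀}}[|H|] < ∞, where H(x) := (1/4)·log(x_{v₁}/x_{v₀}). Let 𝒫 be the set of all probability measures Π on Ω_{e₀} such that Π and ℙ_{v₀,v₁,e₀} are mutually absolutely continuous and both E_Π[H] and E_Π[log(dΠ/dℙ_{v₀,v₁,e₀})] are finite, and define F(Π) := E_Π[H] + E_Π[log(dΠ/dℙ_{v₀,v₁,e₀})]. Then ℚ_{v₀,e₀} ∈ 𝒫, F(ℚ_{v₀,e₀}) = log Z_{v₀,v₁,e₀}, and F(Π) ≥ log Z_{v₀,v₁,e₀} for every Π ∈ 𝒫; that is, F is minimized at Π = ℚ_{v₀,e₀} with minimum value log Z_{v₀,v₁,e₀}. -/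

import Mathlib

open MeasureTheory
open scoped ENNReal Classical

namespace ERRWGraph

noncomputable section

variable {V : Type*} [Fintype V] [DecidableEq V]

/-- The measure `dx/x` on `(0,∞)`, i.e. Lebesgue measure on a logarithmic scale. -/
def logMeasure : Measure ℝ :=
  (volume.restrict (Set.Ioi (0 : ℝ))).withDensity fun x => ENNReal.ofReal (1 / x)

variable (G : SimpleGraph V) [Fintype G.edgeSet]

/-- The set `Ω_{e₀}` of strictly positive edge weights normalized at the reference
edge `e₀`. -/
def Omega (e₀ : G.edgeSet) : Set (G.edgeSet → ℝ) :=
  {x | (∀ e, 0 < x e) ∧ x e₀ = 1}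

/-- The reference measure `ρ_{e₀} = δ₁(dx_{e₀}) ∏_{e ≠ e₀} dx_e/x_e`, realized as a
measure on `(0,∞)^E ⊆ ℝ^E` concentrated on `Ω_{e₀}`. -/
def rho (e₀ : G.edgeSet) : Measure (G.edgeSet → ℝ) :=
  Measure.pi fun e => if e = e₀ then Measure.dirac 1 else logMeasure

/-- Vertex weight `x_v = ∑_{e ∋ v} x_e`. -/
def vwt (x : G.edgeSet → ℝ) (v : V) : ℝ :=
  ∑ e : G.edgeSet, if v ∈ (e : Sym2 V) then x e else 0

/-- Vertex weight `a_v = ∑_{e ∋ v} a_e` of the initial weights `a : Sym2 V → ℝ`. -/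
def avwt (a : Sym2 V → ℝ) (v : V) : ℝ :=
  ∑ e : G.edgeSet, if v ∈ (e : Sym2 V) then a (e : Sym2 V) else 0

/-- A set `T` of edges of `G` is a spanning tree iff the graph with edge set `T`
is a tree (i.e. a maximal connected acyclic subgraph of `G`). -/
def IsSpanningTree (T : Finset G.edgeSet) : Prop :=
  (SimpleGraph.fromEdgeSet (Subtype.val '' (T : Set G.edgeSet))).IsTree

/-- `∑_{T ∈ 𝒯} ∏_{e ∈ T} x_e`, the sum over spanning trees of `G`. -/
def treeSum (x : G.edgeSet → ℝ) : ℝ :=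
  ∑ T : Finset G.edgeSet, if IsSpanningTree G T then (∏ e ∈ T, x e) else 0

/-- The function `Φ_{v₀,a}` from the Coppersmith–Diaconis description of the
mixing measure. -/
def Phi (a : Sym2 V → ℝ) (v₀ : V) (x : G.edgeSet → ℝ) : ℝ :=
  (∏ e : G.edgeSet, x e ^ a (e : Sym2 V)) * vwt G x v₀ ^ (-avwt G a v₀ / 2) *
    (∏ v ∈ Finset.univ.erase v₀, vwt G x v ^ (-(avwt G a v + 1) / 2)) *
    Real.sqrt (treeSum G x)

/-- The normalizing constant `z_{v₀,e₀} = ∫ Φ_{v₀,a} dρ_{e₀}`. -/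
def z (a : Sym2 V → ℝ) (v₀ : V) (e₀ : G.edgeSet) : ℝ≥0∞ :=
  ∫⁻ x, ENNReal.ofReal (Phi G a v₀ x) ∂rho G e₀

/-- The mixing measure `ℚ_{v₀,e₀}`, with density `Φ_{v₀,a}/z_{v₀,e₀}` w.r.t. `ρ_{e₀}`. -/
def Qm (a : Sym2 V → ℝ) (v₀ : V) (e₀ : G.edgeSet) : Measure (G.edgeSet → ℝ) :=
  (z G a v₀ e₀)⁻¹ • (rho G e₀).withDensity fun x => ENNReal.ofReal (Phi G a v₀ x)

/-- The density `((Φ_{v₀,a}/z_{v₀,e₀})·(Φ_{v₁,a}/z_{v₁,e₀}))^{1/2}` of the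
interpolated measure. -/
def interpDens (a : Sym2 V → ℝ) (v₀ v₁ : V) (e₀ : G.edgeSet) (x : G.edgeSet → ℝ) : ℝ≥0∞ :=
  (ENNReal.ofReal (Phi G a v₀ x) / z G a v₀ e₀ *
    (ENNReal.ofReal (Phi G a v₁ x) / z G a v₁ e₀)) ^ (1 / 2 : ℝ)

/-- The normalizing constant `Z_{v₀,v₁,e₀}` of the interpolated measure. -/
def Zc (a : Sym2 V → ℝ) (v₀ v₁ : V) (e₀ : G.edgeSet) : ℝ≥0∞ :=
  ∫⁻ x, interpDens G a v₀ v₁ e₀ x ∂rho G e₀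

/-- The interpolated measure `ℙ_{v₀,v₁,e₀}`. -/
def Pm (a : Sym2 V → ℝ) (v₀ v₁ : V) (e₀ : G.edgeSet) : Measure (G.edgeSet → ℝ) :=
  (Zc G a v₀ v₁ e₀)⁻¹ • (rho G e₀).withDensity (interpDens G a v₀ v₁ e₀)

/-- `f` is an automorphism of the weighted graph `(G,a)`. -/
def IsAut (a : Sym2 V → ℝ) (f : V → V) : Prop :=
  Function.Bijective f ∧ (∀ u v : V, G.Adj (f u) (f v) ↔ G.Adj u v) ∧
    ∀ u v : V, G.Adj u v → a s(f u, f v) = a s(u, v)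

/-- Assumption 2.3 of the paper. -/
def Assumption23 (a φ : Sym2 V → ℝ) (v₀ v₁ : V) (e₀ : G.edgeSet) : Prop :=
  v₀ ≠ v₁ ∧ ¬G.Adj v₀ v₁ ∧ v₀ ∈ (e₀ : Sym2 V) ∧
    (∃ f : V → V, IsAut G a f ∧ f v₀ = v₁ ∧ f v₁ = v₀) ∧
    (∀ e : G.edgeSet, φ (e : Sym2 V) ∈ Set.Icc (0 : ℝ) 1) ∧
    (∀ e : G.edgeSet, v₀ ∈ (e : Sym2 V) → φ (e : Sym2 V) = 0) ∧
    (∀ e : G.edgeSet, v₁ ∈ (e : Sym2 V) → φ (e : Sym2 V) = 1)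

/-- `max_{e,e' ∋ v} (φ(e) - φ(e'))²`. -/
def maxsq (φ : Sym2 V → ℝ) (v : V) : ℝ :=
  sSup ((fun p : G.edgeSet × G.edgeSet =>
      (φ (p.1 : Sym2 V) - φ (p.2 : Sym2 V)) ^ 2) ''
    {p : G.edgeSet × G.edgeSet | v ∈ (p.1 : Sym2 V) ∧ v ∈ (p.2 : Sym2 V)})

/-- The "Dirichlet form" `S_φ`. -/
def Sphi (a φ : Sym2 V → ℝ) : ℝ :=
  ∑ v : V, (avwt G a v + 1) / 2 * maxsq G φ v

/-- `H_{v₀,v₁}(x) = (1/4) log (x_{v₁}/x_{v₀})`. -/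
def Hfun (v₀ v₁ : V) (x : G.edgeSet → ℝ) : ℝ :=
  (1 / 4) * Real.log (vwt G x v₁ / vwt G x v₀)

/-- `log (dQ/dP)` realized via the Radon–Nikodym derivative. -/
def logRN {α : Type*} [MeasurableSpace α] (Q P : Measure α) (x : α) : ℝ :=
  Real.log ((Q.rnDeriv P x).toReal)

/-- The deformation map `Ξ^{γφ}(x) = (e^{γφ(e)} x_e)_{e∈E}`. -/
def Xi (φ : Sym2 V → ℝ) (γ : ℝ) (x : G.edgeSet → ℝ) : G.edgeSet → ℝ :=
  fun e => Real.exp (γ * φ (e : Sym2 V)) * x e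

/-- `Π^{γφ}`, the image of `ℙ_{v₀,v₁,e₀}` under `Ξ^{γφ}`. -/
def PiGamma (a φ : Sym2 V → ℝ) (v₀ v₁ : V) (e₀ : G.edgeSet) (γ : ℝ) :
    Measure (G.edgeSet → ℝ) :=
  Measure.map (Xi G φ γ) (Pm G a v₀ v₁ e₀)

/-- The explicit realization `f_γ` of `log(dΠ^{γφ}/dℙ_{v₀,v₁,e₀}) ∘ Ξ^{γφ}`. -/
def fgamma (a φ : Sym2 V → ℝ) (v₀ v₁ : V) (γ : ℝ) (x : G.edgeSet → ℝ) : ℝ :=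
  γ * (avwt G a v₁ / 2 + 1 / 4) -
    γ * ∑ e : G.edgeSet, φ (e : Sym2 V) * a (e : Sym2 V) +
    (∑ v ∈ Finset.univ \ {v₀, v₁}, (avwt G a v + 1) / 2 *
      Real.log (vwt G (Xi G φ γ x) v / vwt G x v)) -
    (1 / 2) * Real.log (treeSum G (Xi G φ γ x) / treeSum G x)

/-- Mean of `φ` under the measure `μ_{x,v,γ}` on the edges incident to `v`. -/
def muMean (φ : Sym2 V → ℝ) (γ : ℝ) (x : G.edgeSet → ℝ) (v : V) : ℝ :=
  (∑ e : G.edgeSet, if v ∈ (e : Sym2 V) then φ (e : Sym2 V) * Xi G φ γ x e else 0) /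
    vwt G (Xi G φ γ x) v

/-- Variance of `φ` under `μ_{x,v,γ}`. -/
def muVar (φ : Sym2 V → ℝ) (γ : ℝ) (x : G.edgeSet → ℝ) (v : V) : ℝ :=
  (∑ e : G.edgeSet, if v ∈ (e : Sym2 V) then
      (φ (e : Sym2 V) - muMean G φ γ x v) ^ 2 * Xi G φ γ x e else 0) /
    vwt G (Xi G φ γ x) v

/-- `Δ(T) = ∑_{e ∈ T} φ(e)`. -/
def Delta (φ : Sym2 V → ℝ) (T : Finset G.edgeSet) : ℝ := ∑ e ∈ T, φ (e : Sym2 V)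

/-- Mean of `Δ` under the measure `ν_{x,γ}` on spanning trees. -/
def nuMean (φ : Sym2 V → ℝ) (γ : ℝ) (x : G.edgeSet → ℝ) : ℝ :=
  (∑ T : Finset G.edgeSet, if IsSpanningTree G T then
      Delta G φ T * ∏ e ∈ T, Xi G φ γ x e else 0) /
    treeSum G (Xi G φ γ x)

/-- Variance of `Δ` under `ν_{x,γ}`. -/
def nuVar (φ : Sym2 V → ℝ) (γ : ℝ) (x : G.edgeSet → ℝ) : ℝ :=
  (∑ T : Finset G.edgeSet, if IsSpanningTree G T then
      (Delta G φ T - nuMean G φ γ x) ^ 2 * ∏ e ∈ T, Xi G φ γ x e else 0) /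
    treeSum G (Xi G φ γ x)

/-- The claimed first derivative of `γ ↦ f_γ(x)`. -/
def fder1 (a φ : Sym2 V → ℝ) (v₀ v₁ : V) (x : G.edgeSet → ℝ) (γ : ℝ) : ℝ :=
  avwt G a v₁ / 2 + 1 / 4 - (∑ e : G.edgeSet, φ (e : Sym2 V) * a (e : Sym2 V)) +
    (∑ v ∈ Finset.univ \ {v₀, v₁}, (avwt G a v + 1) / 2 * muMean G φ γ x v) -
    (1 / 2) * nuMean G φ γ x

/-- The claimed second derivative of `γ ↦ f_γ(x)`. -/
def fder2 (a φ : Sym2 V → ℝ) (v₀ v₁ : V) (x : G.edgeSet → ℝ) (γ : ℝ) : ℝ :=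
  (∑ v ∈ Finset.univ \ {v₀, v₁}, (avwt G a v + 1) / 2 * muVar G φ γ x v) -
    (1 / 2) * nuVar G φ γ x

/-- Membership in the class `𝒫` of the variational principle. -/
def VarP (a : Sym2 V → ℝ) (v₀ v₁ : V) (e₀ : G.edgeSet)
    (Q : Measure (G.edgeSet → ℝ)) : Prop :=
  IsProbabilityMeasure Q ∧ Q ≪ Pm G a v₀ v₁ e₀ ∧ Pm G a v₀ v₁ e₀ ≪ Q ∧
    Integrable (Hfun G v₀ v₁) Q ∧ Integrable (logRN Q (Pm G a v₀ v₁ e₀)) Q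

/-- The functional `F(Π) = E_Π[H] + E_Π[log(dΠ/dℙ_{v₀,v₁,e₀})]`. -/
def Ffun (a : Sym2 V → ℝ) (v₀ v₁ : V) (e₀ : G.edgeSet)
    (Q : Measure (G.edgeSet → ℝ)) : ℝ :=
  (∫ x, Hfun G v₀ v₁ x ∂Q) + ∫ x, logRN Q (Pm G a v₀ v₁ e₀) x ∂Q

end

end ERRWGraph

namespace ERRWGraph

open Real in
/-- Gibbs variational principle: `Q` minimizes the free energy relative to its exponential tilt
`Q.tilted H`. -/
theorem gibbs_variational_principle {α : Type*} [MeasurableSpace α] (Q : Measure α)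
    [IsProbabilityMeasure Q] {H : α → ℝ} (hH : Integrable H Q)
    (hexp : Integrable (fun x => exp (H x)) Q) :
    Integrable (llr Q (Q.tilted H)) Q ∧
      ∫ x, H x ∂Q + ∫ x, llr Q (Q.tilted H) x ∂Q = log (∫ x, exp (H x) ∂Q) ∧
      ∀ ν : Measure α, IsProbabilityMeasure ν → ν ≪ Q.tilted H → Integrable H ν →
        Integrable (llr ν (Q.tilted H)) ν →
        log (∫ x, exp (H x) ∂Q) ≤ ∫ x, H x ∂ν + ∫ x, llr ν (Q.tilted H) x ∂ν := by
  have hself : Integrable (llr Q Q) Q :=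
    (integrable_congr (llr_self Q)).2 (integrable_zero _ _ _)
  have hint : ∫ x, llr Q Q x ∂Q = 0 := by
    rw [integral_congr_ae (llr_self Q)]; simp
  refine ⟨integrable_llr_tilted_right .rfl hH hself hexp, ?_, fun ν _ hRP hHR hllr => ?_⟩
  · rw [integral_llr_tilted_right .rfl hH hexp hself, hint]; ring
  · have hRQ : ν ≪ Q := hRP.trans (tilted_absolutelyContinuous Q H)
    have hRint : Integrable (llr ν Q) ν := by
      refine ((hllr.add hHR).sub (integrable_const (log (∫ x, exp (H x) ∂Q)))).congr ?_
      filter_upwards [llr_tilted_right hRQ hexp] with x hx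
      simp only [Pi.add_apply, Pi.sub_apply, hx]; ring
    rw [integral_llr_tilted_right hRQ hHR hexp hRint]
    have := InformationTheory.integral_llr_add_sub_measure_univ_nonneg hRQ hRint
    simp only [probReal_univ] at this
    linarith

lemma map_exp_volume : (volume : Measure ℝ).map Real.exp = logMeasure := by
  ext s hs
  rw [Measure.map_apply Real.measurable_exp hs, logMeasure, withDensity_apply _ hs,
    Measure.restrict_restrict hs, ← lintegral_indicator_one (Real.measurable_exp hs)]
  have h := lintegral_image_eq_lintegral_abs_deriv_mul (f := Real.exp) (f' := Real.exp)
    MeasurableSet.univ (fun x _ => (Real.hasDerivAt_exp x).hasDerivWithinAt)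
    Real.exp_injective.injOn (s.indicator fun x => ENNReal.ofReal (1 / x))
  rw [Set.image_univ, Real.range_exp, setLIntegral_indicator hs, Measure.restrict_univ] at h
  rw [h]
  refine lintegral_congr fun x => ?_
  by_cases hx : Real.exp x ∈ s
  · rw [Set.indicator_of_mem hx, Set.indicator_of_mem (by exact hx),
      ← ENNReal.ofReal_mul (abs_nonneg _), abs_of_pos (Real.exp_pos x),
      mul_one_div_cancel (Real.exp_pos x).ne']
    simp
  · rw [Set.indicator_of_notMem hx, Set.indicator_of_notMem (by exact hx), mul_zero]

/-- Product of Lebesgue measures, pinned to `0` at the coordinate `i₀`. -/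
noncomputable def pinnedVolume {ι : Type*} [Fintype ι] [DecidableEq ι] (i₀ : ι) :
    Measure (ι → ℝ) :=
  Measure.pi fun i => if i = i₀ then Measure.dirac 0 else volume

instance sigmaFinite_ite_dirac {α : Type*} [MeasurableSpace α] (p : Prop) [Decidable p] (c : α)
    (μ : Measure α) [SigmaFinite μ] : SigmaFinite (if p then Measure.dirac c else μ) := by
  split_ifs <;> infer_instance

instance {ι : Type*} [Fintype ι] [DecidableEq ι] (i₀ : ι) : SigmaFinite (pinnedVolume i₀) := by
  unfold pinnedVolume; infer_instance

lemma map_pinnedVolume_prod {ι : Type*} [Fintype ι] [DecidableEq ι] (i₀ : ι) :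
    ((pinnedVolume i₀).prod volume).map (fun p : (ι → ℝ) × ℝ => fun i => p.1 i + p.2) =
      volume := by
  symm
  refine Measure.pi_eq fun s hs => ?_
  have hm : Measurable (fun p : (ι → ℝ) × ℝ => fun i => p.1 i + p.2) := by fun_prop
  rw [Measure.map_apply hm (.univ_pi hs),
    Measure.prod_apply_symm (hm (.univ_pi hs)), ← Finset.mul_prod_erase _ _ (Finset.mem_univ i₀),
    ← lintegral_indicator_one (hs i₀), ← lintegral_mul_const _ (measurable_one.indicator (hs i₀))]
  refine lintegral_congr fun t => ?_
  have hset : (fun u : ι → ℝ => (u, t)) ⁻¹' ((fun p : (ι → ℝ) × ℝ => fun i => p.1 i + p.2) ⁻¹'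
      Set.univ.pi s) = Set.univ.pi fun i => (· + t) ⁻¹' s i := by
    ext u; simp
  rw [hset, pinnedVolume, Measure.pi_pi, ← Finset.mul_prod_erase _ _ (Finset.mem_univ i₀)]
  congr 1
  · simp only [if_true]
    rw [Measure.dirac_apply' _ ((measurable_add_const t) (hs i₀))]
    simp [Set.indicator]
  · refine Finset.prod_congr rfl fun i hi => ?_
    rw [if_neg (Finset.ne_of_mem_erase hi), measure_preimage_add_right]

/-- A translation-invariant function has the same integral for every choice of pinned coordinate,
namely its integral over the slab `{u | 0 ≤ u i ≤ 1}` for an arbitrary `i`. -/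
lemma lintegral_pinnedVolume {ι : Type*} [Fintype ι] [DecidableEq ι] (i₀ i : ι)
    {g : (ι → ℝ) → ℝ≥0∞} (hg : Measurable g) (hinv : ∀ u t, g (fun j => u j + t) = g u) :
    ∫⁻ u, g u ∂pinnedVolume i₀ =
      ∫⁻ u, g u * (Set.Icc (0 : ℝ) 1).indicator 1 (u i) ∂volume := by
  have hm : Measurable (fun p : (ι → ℝ) × ℝ => fun i => p.1 i + p.2) := by fun_prop
  have hI : Measurable ((Set.Icc (0 : ℝ) 1).indicator (1 : ℝ → ℝ≥0∞)) :=
    measurable_one.indicator measurableSet_Icc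
  rw [← map_pinnedVolume_prod i₀, lintegral_map (by fun_prop) hm,
    lintegral_prod _ (by fun_prop)]
  refine lintegral_congr fun u => ?_
  simp only [hinv]
  rw [lintegral_const_mul _ (by fun_prop),
    lintegral_add_left_eq_self (fun t => (Set.Icc (0 : ℝ) 1).indicator (1 : ℝ → ℝ≥0∞) t),
    lintegral_indicator_one measurableSet_Icc]
  simp

lemma rho_eq_map_pinnedVolume {V : Type*} [DecidableEq V] (G : SimpleGraph V)
    [Fintype G.edgeSet] (e₀ : G.edgeSet) : rho G e₀ = (pinnedVolume e₀).map
    (fun u e => Real.exp (u e)) := by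
  have h (e : G.edgeSet) : (if e = e₀ then Measure.dirac 0 else volume : Measure ℝ).map Real.exp =
      if e = e₀ then Measure.dirac 1 else logMeasure := by
    split_ifs
    · rw [Measure.map_dirac' Real.measurable_exp, Real.exp_zero]
    · exact map_exp_volume
  have : SigmaFinite logMeasure := by
    unfold logMeasure
    exact SigmaFinite.withDensity_ofReal _
  have hs (e : G.edgeSet) : SigmaFinite
      ((if e = e₀ then Measure.dirac 0 else volume : Measure ℝ).map Real.exp) := by
    rw [h]; infer_instance
  rw [pinnedVolume, Measure.pi_map_pi fun _ => Real.measurable_exp.aemeasurable]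
  simp only [h]
  rfl

section Graph

variable {V : Type*} (G : SimpleGraph V)

lemma exists_edge_mem {G : SimpleGraph V} (hG : G.Connected) (e₀ : G.edgeSet) (v : V) :
    ∃ e : G.edgeSet, v ∈ (e : Sym2 V) := by
  obtain ⟨⟨u, w⟩, h⟩ := e₀
  have : Nontrivial V := ⟨u, w, G.ne_of_adj h⟩
  obtain ⟨y, hy⟩ := hG.preconnected.exists_adj_of_nontrivial v
  exact ⟨⟨s(v, y), hy⟩, Sym2.mem_mk_left v y⟩

lemma vwt_pos [DecidableEq V] {G : SimpleGraph V} [Fintype G.edgeSet] (hG : G.Connected)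
    (e₀ : G.edgeSet)
    {x : G.edgeSet → ℝ} (hx : ∀ e, 0 < x e) (v : V) : 0 < vwt G x v := by
  obtain ⟨e, he⟩ := exists_edge_mem hG e₀ v
  refine Finset.sum_pos' (fun e' _ => ?_) ⟨e, Finset.mem_univ e, by simpa [he] using hx e⟩
  split_ifs
  · exact (hx e').le
  · exact le_rfl

lemma exists_isSpanningTree {G : SimpleGraph V} [Fintype G.edgeSet] (hG : G.Connected) :
    ∃ T : Finset G.edgeSet, IsSpanningTree G T := by
  obtain ⟨T, hle, hT⟩ := hG.exists_isTree_le
  refine ⟨Finset.univ.filter fun e : G.edgeSet => (e : Sym2 V) ∈ T.edgeSet, ?_⟩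
  have : Subtype.val '' ((Finset.univ.filter fun e : G.edgeSet => (e : Sym2 V) ∈ T.edgeSet :
      Finset G.edgeSet) : Set G.edgeSet) = T.edgeSet := by
    ext e
    simpa using fun he => SimpleGraph.edgeSet_mono hle he
  rwa [IsSpanningTree, this, SimpleGraph.fromEdgeSet_edgeSet]

lemma treeSum_pos {G : SimpleGraph V} [Fintype G.edgeSet] (hG : G.Connected)
    {x : G.edgeSet → ℝ} (hx : ∀ e, 0 < x e) : 0 < treeSum G x := by
  obtain ⟨T, hT⟩ := exists_isSpanningTree hG
  have hpos (S : Finset G.edgeSet) : 0 < ∏ e ∈ S, x e := Finset.prod_pos fun e _ => hx e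
  refine Finset.sum_pos' (fun S _ => ?_) ⟨T, Finset.mem_univ T, by simpa [hT] using hpos T⟩
  split_ifs
  · exact (hpos S).le
  · exact le_rfl

lemma Phi_pos [Fintype V] [DecidableEq V] {G : SimpleGraph V} [Fintype G.edgeSet]
    (hG : G.Connected) (e₀ : G.edgeSet)
    (a : Sym2 V → ℝ) (v : V) {x : G.edgeSet → ℝ} (hx : ∀ e, 0 < x e) : 0 < Phi G a v x := by
  have hv := vwt_pos hG e₀ hx
  exact mul_pos (mul_pos (mul_pos (Finset.prod_pos fun e _ => Real.rpow_pos_of_pos (hx e) _)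
    (Real.rpow_pos_of_pos (hv v) _)) (Finset.prod_pos fun w _ => Real.rpow_pos_of_pos (hv w) _))
    (Real.sqrt_pos.2 (treeSum_pos hG hx))

lemma measurable_vwt [DecidableEq V] [Fintype G.edgeSet] (v : V) :
    Measurable fun x => vwt G x v := by
  unfold vwt
  refine Finset.measurable_sum _ fun e _ => ?_
  split_ifs <;> fun_prop

lemma measurable_treeSum [Fintype G.edgeSet] : Measurable (treeSum G) := by
  unfold treeSum
  refine Finset.measurable_sum _ fun T _ => ?_
  split_ifs <;> fun_prop

lemma measurable_Phi [Fintype V] [DecidableEq V] [Fintype G.edgeSet] (a : Sym2 V → ℝ) (v : V) :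
    Measurable (Phi G a v) := by
  have h1 := measurable_vwt G
  have h2 := measurable_treeSum G
  unfold Phi
  fun_prop

lemma measurable_Hfun [DecidableEq V] [Fintype G.edgeSet] (v₀ v₁ : V) : Measurable
    (Hfun G v₀ v₁) := by
  have h1 := measurable_vwt G
  unfold Hfun
  fun_prop

/-- A product form of `Phi` which isolates the dependence on the base vertex. -/
lemma Phi_eq [Fintype V] [DecidableEq V] {G : SimpleGraph V} [Fintype G.edgeSet]
    (hG : G.Connected) (e₀ : G.edgeSet)
    (a : Sym2 V → ℝ) (v : V) {x : G.edgeSet → ℝ} (hx : ∀ e, 0 < x e) :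
    Phi G a v x = (∏ e : G.edgeSet, x e ^ a (e : Sym2 V)) *
      (∏ w, vwt G x w ^ (-(avwt G a w + 1) / 2)) * √(treeSum G x) * vwt G x v ^ (1 / 2 : ℝ) := by
  rw [Phi, ← Finset.mul_prod_erase Finset.univ _ (Finset.mem_univ v),
    show -avwt G a v / 2 = -(avwt G a v + 1) / 2 + 1 / 2 by ring,
    Real.rpow_add (vwt_pos hG e₀ hx v)]
  ring

lemma Phi_eq_mul_exp_Hfun [Fintype V] [DecidableEq V] {G : SimpleGraph V} [Fintype G.edgeSet]
    (hG : G.Connected)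
    (e₀ : G.edgeSet) (a : Sym2 V → ℝ) (v₀ v₁ : V) {x : G.edgeSet → ℝ} (hx : ∀ e, 0 < x e) :
    Phi G a v₁ x = Phi G a v₀ x * Real.exp (Hfun G v₀ v₁ x) ^ 2 := by
  have h0 := vwt_pos hG e₀ hx v₀
  have h1 := vwt_pos hG e₀ hx v₁
  have h : vwt G x v₁ ^ (1 / 2 : ℝ) =
      vwt G x v₀ ^ (1 / 2 : ℝ) * Real.exp (Hfun G v₀ v₁ x) ^ 2 := by
    rw [Hfun, Real.log_div h1.ne' h0.ne', ← Real.exp_nat_mul, Real.rpow_def_of_pos h0,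
      Real.rpow_def_of_pos h1, ← Real.exp_add]
    congr 1
    push_cast
    ring
  rw [Phi_eq hG e₀ a v₁ hx, Phi_eq hG e₀ a v₀ hx, h]
  ring

lemma vwt_smul [DecidableEq V] [Fintype G.edgeSet] (s : ℝ) (x : G.edgeSet → ℝ) (v : V) :
    vwt G (fun e => s * x e) v = s * vwt G x v := by
  simp only [vwt, Finset.mul_sum, mul_ite, mul_zero]

lemma IsSpanningTree.card_add_one [Fintype V] {G : SimpleGraph V} [Fintype G.edgeSet]
    {T : Finset G.edgeSet}
    (hT : IsSpanningTree G T) : T.card + 1 = Fintype.card V := by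
  rw [← SimpleGraph.IsTree.card_edgeFinset hT]
  congr 1
  rw [← Finset.card_map (Function.Embedding.subtype _)]
  congr 1
  ext e
  simp only [Finset.mem_map, SimpleGraph.mem_edgeFinset, SimpleGraph.edgeSet_fromEdgeSet,
    Function.Embedding.subtype_apply, Set.mem_sdiff, Set.mem_image, Finset.mem_coe]
  refine ⟨fun h => ⟨h, ?_⟩, fun h => h.1⟩
  obtain ⟨e, -, rfl⟩ := h
  exact G.not_isDiag_of_mem_edgeSet e.2

lemma treeSum_smul [Fintype V] [Fintype G.edgeSet] (s : ℝ) (x : G.edgeSet → ℝ) :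
    treeSum G (fun e => s * x e) = s ^ (Fintype.card V - 1) * treeSum G x := by
  simp only [treeSum, Finset.mul_sum]
  refine Finset.sum_congr rfl fun T _ => ?_
  split_ifs with hT
  · rw [Finset.prod_mul_distrib, Finset.prod_const, ← hT.card_add_one, Nat.add_sub_cancel]
  · rw [mul_zero]

lemma sum_avwt [Fintype V] [DecidableEq V] [Fintype G.edgeSet] (a : Sym2 V → ℝ) :
    ∑ v, avwt G a v = 2 * ∑ e : G.edgeSet, a e := by
  simp only [avwt]
  rw [Finset.sum_comm, Finset.mul_sum]
  refine Finset.sum_congr rfl fun e _ => ?_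
  obtain ⟨⟨u, w⟩, h⟩ := e
  rw [Finset.sum_ite, Finset.sum_const_zero, add_zero, Finset.sum_const]
  have : (Finset.univ.filter fun v => v ∈ (s(u, w) : Sym2 V)) = {u, w} := by ext; simp
  have hc : (Finset.univ.filter fun v => v ∈ (s(u, w) : Sym2 V)).card = 2 := by
    rw [this, Finset.card_pair (G.ne_of_adj h)]
  erw [hc]
  simp

lemma Phi_smul [Fintype V] [DecidableEq V] {G : SimpleGraph V} [Fintype G.edgeSet]
    (hG : G.Connected) (e₀ : G.edgeSet)
    (a : Sym2 V → ℝ) (v : V) {x : G.edgeSet → ℝ} (hx : ∀ e, 0 < x e) {s : ℝ} (hs : 0 < s) :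
    Phi G a v (fun e => s * x e) = Phi G a v x := by
  have hv := fun w => (vwt_pos hG e₀ hx w).le
  have hcard : 1 ≤ Fintype.card V := Fintype.card_pos_iff.2 ⟨v⟩
  have hsqrt : √(s ^ (Fintype.card V - 1)) = s ^ (((Fintype.card V : ℝ) - 1) / 2) := by
    rw [Real.sqrt_eq_rpow, ← Real.rpow_natCast, ← Real.rpow_mul hs.le, Nat.cast_sub hcard]
    congr 1
    push_cast
    ring
  rw [Phi_eq hG e₀ a v (fun e => mul_pos hs (hx e)), Phi_eq hG e₀ a v hx]
  simp only [vwt_smul, treeSum_smul, Real.mul_rpow hs.le (hx _).le, Real.mul_rpow hs.le (hv _),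
    Finset.prod_mul_distrib, ← Real.rpow_sum_of_pos hs]
  rw [Real.sqrt_mul (by positivity), hsqrt]
  have hexp : s ^ (∑ e : G.edgeSet, a e) * s ^ (∑ w, -(avwt G a w + 1) / 2) *
      s ^ (((Fintype.card V : ℝ) - 1) / 2) * s ^ (1 / 2 : ℝ) = 1 := by
    rw [← Real.rpow_add hs, ← Real.rpow_add hs, ← Real.rpow_add hs, ← Finset.sum_div,
      Finset.sum_neg_distrib, Finset.sum_add_distrib, sum_avwt, ← Real.rpow_zero s]
    congr 1
    simp
    ring
  linear_combination ((∏ e : G.edgeSet, x e ^ a (e : Sym2 V)) *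
      (∏ w, vwt G x w ^ (-(avwt G a w + 1) / 2)) * √(treeSum G x) * vwt G x v ^ (1 / 2 : ℝ)) * hexp

section Iso

variable {G} (φ : G ≃g G)

lemma mem_mapEdgeSet_iff (e : G.edgeSet) (v : V) :
    φ v ∈ (φ.mapEdgeSet e : Sym2 V) ↔ v ∈ (e : Sym2 V) := by
  obtain ⟨⟨u, w⟩, h⟩ := e
  change φ v ∈ s(φ u, φ w) ↔ v ∈ s(u, w)
  simp

lemma vwt_comp_iso [DecidableEq V] [Fintype G.edgeSet] (x : G.edgeSet → ℝ) (v : V) :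
    vwt G (fun e => x (φ.mapEdgeSet e)) v = vwt G x (φ v) := by
  unfold vwt
  rw [← φ.mapEdgeSet.sum_comp fun e => if φ v ∈ (e : Sym2 V) then x e else 0]
  simp only [mem_mapEdgeSet_iff]

lemma isSpanningTree_map_iff (T : Finset G.edgeSet) :
    IsSpanningTree G (T.map φ.mapEdgeSet.toEmbedding) ↔ IsSpanningTree G T := by
  unfold IsSpanningTree
  refine (SimpleGraph.Iso.isTree_iff ⟨φ.toEquiv, fun {u w} => ?_⟩).symm
  simp only [SimpleGraph.fromEdgeSet_adj, ne_eq, EmbeddingLike.apply_eq_iff_eq]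
  refine and_congr ?_ Iff.rfl
  constructor
  · rintro ⟨e', he', heq⟩
    obtain ⟨e, he, rfl⟩ := Finset.mem_map.1 (Finset.mem_coe.1 he')
    refine ⟨e, he, ?_⟩
    exact Sym2.map.injective φ.injective heq
  · rintro ⟨e, he, heq⟩
    refine ⟨φ.mapEdgeSet e, Finset.mem_coe.2 (Finset.mem_map_of_mem _ he), ?_⟩
    change Sym2.map φ e = _
    rw [heq]
    rfl

lemma treeSum_comp_iso [Fintype G.edgeSet] (x : G.edgeSet → ℝ) :
    treeSum G (fun e => x (φ.mapEdgeSet e)) = treeSum G x := by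
  unfold treeSum
  rw [← φ.mapEdgeSet.finsetCongr.sum_comp
    fun T => if IsSpanningTree G T then ∏ e ∈ T, x e else 0]
  simp only [Equiv.finsetCongr_apply, isSpanningTree_map_iff, Finset.prod_map,
    Equiv.coe_toEmbedding]

lemma avwt_iso [DecidableEq V] [Fintype G.edgeSet] {a : Sym2 V → ℝ}
    (ha : ∀ e : G.edgeSet, a (φ.mapEdgeSet e) = a e) (v : V) :
    avwt G a (φ v) = avwt G a v := by
  have h := vwt_comp_iso φ (fun e => a e) v
  simp only [ha] at h
  exact h.symm

lemma Phi_comp_iso [Fintype V] [DecidableEq V] [Fintype G.edgeSet] {a : Sym2 V → ℝ}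
    (ha : ∀ e : G.edgeSet, a (φ.mapEdgeSet e) = a e) (v : V)
    (x : G.edgeSet → ℝ) :
    Phi G a v (fun e => x (φ.mapEdgeSet e)) = Phi G a (φ v) x := by
  unfold Phi
  rw [treeSum_comp_iso, ← φ.mapEdgeSet.prod_comp fun e => x e ^ a (e : Sym2 V)]
  simp only [vwt_comp_iso, ha, avwt_iso φ ha]
  congr 2
  refine Finset.prod_bij (fun w _ => φ w) (by simp) (by simp) (fun w hw => ?_)
    (by simp [avwt_iso φ ha])
  refine ⟨φ.symm w, ?_, by simp⟩
  simp only [Finset.mem_erase, Finset.mem_univ, and_true, ne_eq] at hw ⊢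
  rintro rfl
  simp at hw

end Iso

lemma z_eq_lintegral_volume [Fintype V] [DecidableEq V] {G : SimpleGraph V} [Fintype G.edgeSet]
    (hG : G.Connected)
    (a : Sym2 V → ℝ) (v : V) (e₀ e : G.edgeSet) :
    z G a v e₀ = ∫⁻ u : G.edgeSet → ℝ, ENNReal.ofReal (Phi G a v fun e => Real.exp (u e)) *
      (Set.Icc (0 : ℝ) 1).indicator 1 (u e) := by
  have hm := measurable_Phi G a v
  have hexp : Measurable fun (u : G.edgeSet → ℝ) e => Real.exp (u e) := by fun_prop
  rw [z, rho_eq_map_pinnedVolume, lintegral_map (by fun_prop) hexp]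
  refine lintegral_pinnedVolume e₀ e (hm.comp hexp).ennreal_ofReal fun u t => ?_
  simp only [Real.exp_add, mul_comm _ (Real.exp t)]
  rw [Phi_smul hG e₀ a v (fun e => Real.exp_pos (u e)) (Real.exp_pos t)]

lemma z_iso [Fintype V] [DecidableEq V] {G : SimpleGraph V} [Fintype G.edgeSet] (hG : G.Connected)
    (φ : G ≃g G)
    {a : Sym2 V → ℝ} (ha : ∀ e : G.edgeSet, a (φ.mapEdgeSet e) = a e) (v : V) (e₀ : G.edgeSet) :
    z G a (φ v) e₀ = z G a v e₀ := by
  have hp := volume_measurePreserving_piCongrLeft (fun _ : G.edgeSet => ℝ) φ.mapEdgeSet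
  rw [z_eq_lintegral_volume hG a (φ v) e₀ (φ.mapEdgeSet e₀), z_eq_lintegral_volume hG a v e₀ e₀,
    ← hp.lintegral_comp_emb (MeasurableEquiv.measurableEmbedding _)]
  refine lintegral_congr fun u => ?_
  rw [← Phi_comp_iso φ ha v fun e =>
    Real.exp (MeasurableEquiv.piCongrLeft (fun _ : G.edgeSet => ℝ) φ.mapEdgeSet u e)]
  simp only [MeasurableEquiv.coe_piCongrLeft, Equiv.piCongrLeft_apply_apply]

lemma ae_rho_pos [DecidableEq V] [Fintype G.edgeSet] (e₀ : G.edgeSet) :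
    ∀ᵐ x ∂rho G e₀, ∀ e, 0 < x e := by
  have hexp : Measurable fun (u : G.edgeSet → ℝ) e => Real.exp (u e) := by fun_prop
  have hpos : MeasurableSet {x : G.edgeSet → ℝ | ∀ e, 0 < x e} := by
    rw [Set.ofPred_forall]
    exact .iInter fun e => measurableSet_lt measurable_const (measurable_pi_apply e)
  rw [rho_eq_map_pinnedVolume, ae_map_iff hexp.aemeasurable hpos]
  exact .of_forall fun u e => Real.exp_pos _

lemma rho_ne_zero [DecidableEq V] [Fintype G.edgeSet] (e₀ : G.edgeSet) : rho G e₀ ≠ 0 := by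
  have hexp : Measurable fun (u : G.edgeSet → ℝ) e => Real.exp (u e) := by fun_prop
  rw [rho_eq_map_pinnedVolume, ← Measure.measure_univ_ne_zero,
    Measure.map_apply hexp .univ, Set.preimage_univ, pinnedVolume, Measure.pi_univ,
    Finset.prod_ne_zero_iff]
  intro e _
  split_ifs <;> simp

lemma z_ne_zero [Fintype V] [DecidableEq V] {G : SimpleGraph V} [Fintype G.edgeSet]
    (hG : G.Connected) (a : Sym2 V → ℝ)
    (v : V) (e₀ : G.edgeSet) : z G a v e₀ ≠ 0 := by
  have hm := measurable_Phi G a v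
  rw [z, ne_eq, lintegral_eq_zero_iff (by fun_prop)]
  intro h
  apply rho_ne_zero G e₀
  rw [← ae_eq_bot, ← Filter.eventually_false_iff_eq_bot]
  filter_upwards [h, ae_rho_pos G e₀] with x hx hpos
  simp only [Pi.zero_apply, ENNReal.ofReal_eq_zero] at hx
  exact absurd hx (Phi_pos hG e₀ a v hpos).not_ge

end Graph

section Tilted

variable {V : Type*} [Fintype V] [DecidableEq V] {G : SimpleGraph V} [Fintype G.edgeSet]
  {a : Sym2 V → ℝ} {v₀ v₁ : V} {e₀ : G.edgeSet}

lemma isProbabilityMeasure_Qm (hG : G.Connected) (hz : z G a v₀ e₀ ≠ ⊤) :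
    IsProbabilityMeasure (Qm G a v₀ e₀) := by
  refine ⟨?_⟩
  rw [Qm, Measure.smul_apply, withDensity_apply _ .univ, Measure.restrict_univ, smul_eq_mul]
  exact ENNReal.inv_mul_cancel (z_ne_zero hG a v₀ e₀) hz

lemma lintegral_Qm {g : (G.edgeSet → ℝ) → ℝ≥0∞} (hg : Measurable g) :
    ∫⁻ x, g x ∂Qm G a v₀ e₀ =
      (z G a v₀ e₀)⁻¹ * ∫⁻ x, ENNReal.ofReal (Phi G a v₀ x) * g x ∂rho G e₀ := by
  rw [Qm, lintegral_smul_measure, smul_eq_mul,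
    lintegral_withDensity_eq_lintegral_mul _ (measurable_Phi G a v₀).ennreal_ofReal hg]
  rfl

lemma interpDens_ae_eq (hG : G.Connected) (hz : z G a v₁ e₀ = z G a v₀ e₀) :
    interpDens G a v₀ v₁ e₀ =ᵐ[rho G e₀] fun x =>
      (z G a v₀ e₀)⁻¹ * (ENNReal.ofReal (Phi G a v₀ x) *
        ENNReal.ofReal (Real.exp (Hfun G v₀ v₁ x))) := by
  filter_upwards [ae_rho_pos G e₀] with x hx
  rw [interpDens, hz, Phi_eq_mul_exp_Hfun hG e₀ a v₀ v₁ hx,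
    ENNReal.ofReal_mul (Phi_pos hG e₀ a v₀ hx).le, ENNReal.ofReal_pow (Real.exp_pos _).le]
  have h : ∀ p q w : ℝ≥0∞, p / w * (p * q ^ 2 / w) = (w⁻¹ * (p * q)) ^ (2 : ℝ) := by
    intro p q w
    rw [ENNReal.rpow_two, div_eq_mul_inv, div_eq_mul_inv]
    ring
  rw [h, ← ENNReal.rpow_mul]
  norm_num

lemma Zc_eq_lintegral_Qm (hG : G.Connected) (hz : z G a v₁ e₀ = z G a v₀ e₀) :
    Zc G a v₀ v₁ e₀ = ∫⁻ x, ENNReal.ofReal (Real.exp (Hfun G v₀ v₁ x)) ∂Qm G a v₀ e₀ := by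
  have hH := measurable_Hfun G v₀ v₁
  rw [lintegral_Qm (by fun_prop), Zc, lintegral_congr_ae (interpDens_ae_eq hG hz),
    lintegral_const_mul' _ _ (ENNReal.inv_ne_top.2 (z_ne_zero hG a v₀ e₀))]

lemma integrable_exp_Hfun (hG : G.Connected) (hz0 : z G a v₀ e₀ ≠ ⊤)
    (hz : z G a v₁ e₀ = z G a v₀ e₀) :
    Integrable (fun x => Real.exp (Hfun G v₀ v₁ x)) (Qm G a v₀ e₀) := by
  have hH := measurable_Hfun G v₀ v₁
  have := isProbabilityMeasure_Qm hG hz0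
  have hsq : Integrable (fun x => Real.exp (Hfun G v₀ v₁ x) ^ 2) (Qm G a v₀ e₀) := by
    refine ⟨by fun_prop, ?_⟩
    rw [hasFiniteIntegral_iff_ofReal (.of_forall fun x => by positivity),
      lintegral_Qm (by fun_prop)]
    have : ∫⁻ x, ENNReal.ofReal (Phi G a v₀ x) *
        ENNReal.ofReal (Real.exp (Hfun G v₀ v₁ x) ^ 2) ∂rho G e₀ = z G a v₁ e₀ := by
      refine lintegral_congr_ae ?_
      filter_upwards [ae_rho_pos G e₀] with x hx
      rw [Phi_eq_mul_exp_Hfun hG e₀ a v₀ v₁ hx, ENNReal.ofReal_mul (Phi_pos hG e₀ a v₀ hx).le]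
    rw [this, hz, ENNReal.inv_mul_cancel (z_ne_zero hG a v₀ e₀) hz0]
    exact ENNReal.one_lt_top
  exact ((memLp_two_iff_integrable_sq (by fun_prop)).2 hsq).integrable one_le_two

lemma Pm_eq_tilted (hG : G.Connected) (hz0 : z G a v₀ e₀ ≠ ⊤)
    (hz : z G a v₁ e₀ = z G a v₀ e₀) :
    Pm G a v₀ v₁ e₀ = (Qm G a v₀ e₀).tilted (Hfun G v₀ v₁) := by
  have hH := measurable_Hfun G v₀ v₁
  have hPhi := measurable_Phi G a v₀
  have := isProbabilityMeasure_Qm hG hz0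
  have hexp := integrable_exp_Hfun hG hz0 hz
  have hZ : Zc G a v₀ v₁ e₀ =
      ENNReal.ofReal (∫ x, Real.exp (Hfun G v₀ v₁ x) ∂Qm G a v₀ e₀) := by
    rw [Zc_eq_lintegral_Qm hG hz,
      ofReal_integral_eq_lintegral_ofReal hexp (.of_forall fun x => (Real.exp_pos _).le)]
  ext s hs
  rw [Pm, Measure.smul_apply, smul_eq_mul, withDensity_congr_ae (interpDens_ae_eq hG hz),
    withDensity_apply _ hs, tilted_apply' _ _ hs, Qm, Measure.restrict_smul,
    lintegral_smul_measure, restrict_withDensity hs, smul_eq_mul,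
    lintegral_withDensity_eq_lintegral_mul _ (by fun_prop) (by fun_prop), ← Qm,
    lintegral_const_mul' _ _ (ENNReal.inv_ne_top.2 (z_ne_zero hG a v₀ e₀)), mul_left_comm]
  congr 1
  rw [← lintegral_const_mul _ (by fun_prop)]
  refine lintegral_congr fun x => ?_
  rw [Pi.mul_apply, ENNReal.ofReal_div_of_pos (integral_exp_pos hexp), ← hZ, div_eq_mul_inv]
  ring

end Tilted

/-- The graph isomorphism underlying an automorphism of a weighted graph. -/
noncomputable def IsAut.toIso {V : Type*} {G : SimpleGraph V}
    {a : Sym2 V → ℝ} {f : V → V} (hf : IsAut G a f) : G ≃g G :=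
  ⟨Equiv.ofBijective f hf.1, fun {u v} => hf.2.1 u v⟩

lemma IsAut.weight_mapEdgeSet {V : Type*} {G : SimpleGraph V}
    {a : Sym2 V → ℝ} {f : V → V} (hf : IsAut G a f) (e : G.edgeSet) :
    a (hf.toIso.mapEdgeSet e) = a e := by
  obtain ⟨⟨u, w⟩, h⟩ := e
  exact hf.2.2 u w h

end ERRWGraph

open ERRWGraph in
/-- Lemma 5.1 (Variational principle): the functional
`F(Π) = E_Π[H] + E_Π[log(dΠ/dℙ_{v₀,v₁,e₀})]` on the class `𝒫` is minimized at
`Π = ℚ_{v₀,e₀}` with minimal value `log Z_{v₀,v₁,e₀}`. -/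
theorem variational_principle {V : Type*} [Fintype V] [DecidableEq V]
    (G : SimpleGraph V) [Fintype G.edgeSet] (hG : G.Connected)
    (a : Sym2 V → ℝ) (ha : ∀ e ∈ G.edgeSet, 0 < a e) (v₀ v₁ : V)
    (hf : ∃ f : V → V, IsAut G a f ∧ f v₀ = v₁ ∧ f v₁ = v₀)
    (e₀ : G.edgeSet)
    (hz0 : z G a v₀ e₀ ≠ ⊤) (hz1 : z G a v₁ e₀ ≠ ⊤)
    (hH : Integrable (Hfun G v₀ v₁) (Qm G a v₀ e₀)) :
    VarP G a v₀ v₁ e₀ (Qm G a v₀ e₀) ∧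
    Ffun G a v₀ v₁ e₀ (Qm G a v₀ e₀) = Real.log (Zc G a v₀ v₁ e₀).toReal ∧
    ∀ Q : Measure (G.edgeSet → ℝ), VarP G a v₀ v₁ e₀ Q →
      Real.log (Zc G a v₀ v₁ e₀).toReal ≤ Ffun G a v₀ v₁ e₀ Q := by
  obtain ⟨f, hf, hfv, -⟩ := hf
  have hz : z G a v₁ e₀ = z G a v₀ e₀ := by
    rw [← hfv]
    exact z_iso hG hf.toIso hf.weight_mapEdgeSet v₀ e₀
  have hprob := isProbabilityMeasure_Qm hG hz0
  have hexp := integrable_exp_Hfun hG hz0 hz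
  have hP := Pm_eq_tilted hG hz0 hz
  have hZ : (Zc G a v₀ v₁ e₀).toReal = ∫ x, Real.exp (Hfun G v₀ v₁ x) ∂Qm G a v₀ e₀ := by
    rw [Zc_eq_lintegral_Qm hG hz, integral_eq_lintegral_of_nonneg_ae
      (.of_forall fun x => (Real.exp_pos _).le) hexp.aestronglyMeasurable]
  obtain ⟨hint, heq, hle⟩ := gibbs_variational_principle (Qm G a v₀ e₀) hH hexp
  rw [← hP] at hint heq hle
  rw [← hZ] at heq hle
  refine ⟨⟨hprob, ?_, ?_, hH, hint⟩, heq, fun Q hQ => hle Q hQ.1 hQ.2.1 hQ.2.2.2.1 hQ.2.2.2.2⟩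
  · rw [hP]
    exact absolutelyContinuous_tilted hexp
  · rw [hP]
    exact tilted_absolutelyContinuous _ _
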